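/- arXiv:1305.1366 — 4 statements merged into one kernel-verified Lean document; each statement's English description precedes it below -/
import Mathlib

section
/- For every integer n ≥ 3, the domination number of the generalized Petersen graph P(n,2) equals ⌈3n/5⌉. -/
namespace PetersenDom

/-- Vertex set of the generalized Petersen graph: `Sum.inl i` is the outer
vertex `u_i`, `Sum.inr i` is the inner vertex `v_i`, indices in `ZMod n`. -/
abbrev PVert (n : ℕ) := ZMod n ⊕ ZMod n

/-- The outer vertex `u_i`. -/
def uV {n : ℕ} (i : ZMod n) : PVert n := Sum.inl i

/-- The inner vertex `v_i`. -/
def vV {n : ℕ} (i : ZMod n) : PVert n := Sum.inr i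

/-- The generalized Petersen graph `P(n,2)`, with edges
`u_i u_{i+1}`, `u_i v_i`, `v_i v_{i+2}` (indices mod `n`). -/
def P2 (n : ℕ) : SimpleGraph (PVert n) :=
  SimpleGraph.fromRel (fun a b =>
    (∃ i : ZMod n, a = uV i ∧ b = uV (i + 1)) ∨
    (∃ i : ZMod n, a = uV i ∧ b = vV i) ∨
    (∃ i : ZMod n, a = vV i ∧ b = vV (i + 2)))

/-- `S` is a dominating set of `G`: every vertex is in `S` or adjacent to a vertex of `S`. -/
def IsDomSet {V : Type*} (G : SimpleGraph V) (S : Set V) : Prop :=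
  ∀ v : V, v ∈ S ∨ ∃ u ∈ S, G.Adj u v

/-- The domination number of `G`. -/
noncomputable def domNum {V : Type*} (G : SimpleGraph V) : ℕ :=
  sInf {k | ∃ S : Set V, IsDomSet G S ∧ S.ncard = k}

/-- `S` is a dominating set of `P_f(n,2) = P(n,2) - u_f`: it avoids `u_f`
and dominates every vertex other than `u_f`. -/
def IsDomSetF (n : ℕ) (f : ZMod n) (S : Set (PVert n)) : Prop :=
  uV f ∉ S ∧ ∀ v : PVert n, v ≠ uV f → v ∈ S ∨ ∃ u ∈ S, (P2 n).Adj u v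

/-- The domination number of `P_f(n,2)`. -/
noncomputable def domNumF (n : ℕ) (f : ZMod n) : ℕ :=
  sInf {k | ∃ S : Set (PVert n), IsDomSetF n f S ∧ S.ncard = k}

/-- `S` is a minimum dominating set of `P_f(n,2)`. -/
def MinDomF (n : ℕ) (f : ZMod n) (S : Set (PVert n)) : Prop :=
  IsDomSetF n f S ∧ S.ncard = domNumF n f

/-- The neighborhood `N(u_f) = {u_{f-1}, u_{f+1}, v_f}` of `u_f` in `P(n,2)`. -/
def Nbr (n : ℕ) (f : ZMod n) : Set (PVert n) := {uV (f - 1), uV (f + 1), vV f}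

/-- The block `B_i`: the 5 consecutive pairs of vertices centered at `u_i, v_i`. -/
def Blk (n : ℕ) (i : ZMod n) : Set (PVert n) :=
  {uV (i-2), uV (i-1), uV i, uV (i+1), uV (i+2),
   vV (i-2), vV (i-1), vV i, vV (i+1), vV (i+2)}

/-- `γ_i(S) = |B_i ∩ S|`. -/
noncomputable def gam (n : ℕ) (i : ZMod n) (S : Set (PVert n)) : ℕ :=
  (Blk n i ∩ S).ncard

/-- `L_i = {v_{i-1}, u_{i-2}, v_{i-2}}`. -/
def Lset (n : ℕ) (i : ZMod n) : Set (PVert n) := {vV (i-1), uV (i-2), vV (i-2)}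

/-- `R_i = {v_{i+1}, u_{i+2}, v_{i+2}}`. -/
def Rset (n : ℕ) (i : ZMod n) : Set (PVert n) := {vV (i+1), uV (i+2), vV (i+2)}

/-- `M_i = {u_{i-1}, v_i, u_{i+1}}`. -/
def Mset (n : ℕ) (i : ZMod n) : Set (PVert n) := {uV (i-1), vV i, uV (i+1)}

/-- `F = {f-2, f-1, f, f+1, f+2}`, the indices of the block `B_f`. -/
def Fset (n : ℕ) (f : ZMod n) : Set (ZMod n) := {f-2, f-1, f, f+1, f+2}

/-- A Type I set: a minimum dominating set `S` of `P_f(n,2)` with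
`γ_i(S) ≥ 2` for all `i`. -/
def TypeI (n : ℕ) (f : ZMod n) (S : Set (PVert n)) : Prop :=
  MinDomF n f S ∧ ∀ i : ZMod n, 2 ≤ gam n i S

/-- The couple number of `S`: the number of indices `i ∉ F` with `γ_i(S) = 2`. -/
noncomputable def coupleNum (n : ℕ) (f : ZMod n) (S : Set (PVert n)) : ℕ :=
  {i : ZMod n | gam n i S = 2 ∧ i ∉ Fset n f}.ncard

/-- A Type II set: a Type I set with `N(u_f) ∩ S = ∅`, `γ_f(S) = 3`, and
`B_f ∩ S = {u_{f-2}, v_{f+1}, v_{f+2}}`. -/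
def TypeII (n : ℕ) (f : ZMod n) (S : Set (PVert n)) : Prop :=
  TypeI n f S ∧ Nbr n f ∩ S = ∅ ∧ gam n f S = 3 ∧
    Blk n f ∩ S = {uV (f-2), vV (f+1), vV (f+2)}

/-- A Type III set: a Type I set with `N(u_f) ∩ S = ∅`, `γ_f(S) = 4`, and
`B_f ∩ S` one of four specified patterns. -/
def TypeIII (n : ℕ) (f : ZMod n) (S : Set (PVert n)) : Prop :=
  TypeI n f S ∧ Nbr n f ∩ S = ∅ ∧ gam n f S = 4 ∧
    (Blk n f ∩ S = {vV (f-1), vV (f+1), uV (f+2), vV (f+2)} ∨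
     Blk n f ∩ S = {uV (f-2), vV (f-2), uV (f+2), vV (f+2)} ∨
     Blk n f ∩ S = {vV (f-2), vV (f-1), vV (f+1), vV (f+2)} ∨
     Blk n f ∩ S = {uV (f-2), vV (f-2), vV (f+1), uV (f+2)})

/-- `⌈3n/5⌉`. -/
noncomputable def ceil35 (n : ℕ) : ℕ := ⌈(3 * (n : ℚ)) / 5⌉₊

/-- The bondage number of `G`: the least number of edges whose deletion
increases the domination number. -/
noncomputable def bondage {V : Type*} (G : SimpleGraph V) : ℕ :=
  sInf {k | ∃ E : Set (Sym2 V), E ⊆ G.edgeSet ∧ E.ncard = k ∧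
    domNum G < domNum (G.deleteEdges E)}

/-- The domination alteration number of `G`: the least number of vertices
whose removal changes the domination number. -/
noncomputable def alterNum {V : Type*} (G : SimpleGraph V) : ℕ :=
  sInf {k | ∃ A : Set V, A.ncard = k ∧ domNum (G.induce Aᶜ) ≠ domNum G}

end PetersenDom
namespace PetersenDom

/-- How column data dominates a vertex so far: `2` if it is chosen, `1` if a neighbour already
seen is chosen, `0` otherwise. -/
def status (chosen seen : Bool) : Fin 3 := bif chosen then 2 else bif seen then 1 else 0

/-- Potential of a cut between two consecutive columns of `P(n,2)`, as a function of the statuses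
of the last outer vertex and of the last two inner vertices before the cut. -/
def potential : Fin 3 → Fin 3 → Fin 3 → ℕ :=
  ![![![10, 7, 6], ![6, 6, 6], ![0, 0, 0]],
    ![![3, 7, 3], ![3, 4, 3], ![5, 3, 3]],
    ![![0, 0, 0], ![5, 4, 1], ![3, 0, 0]]]

/-- The potential of the cut after the columns `0, 1, 2, 3`, where `a j` and `b j` tell whether the
outer and the inner vertex of column `j` are chosen. -/
def cutPotential (a2 a3 b0 b1 b2 b3 : Bool) : ℕ :=
  potential (status a3 (a2 || b3)) (status b3 (a3 || b1)) (status b2 (a2 || b0))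

lemma cutPotential_step : ∀ a2 a3 a4 b0 b1 b2 b3 b4 : Bool,
    (a3 || a2 || a4 || b3) = true → (b2 || a2 || b0 || b4) = true →
    3 + cutPotential a2 a3 b0 b1 b2 b3 ≤
      cutPotential a3 a4 b1 b2 b3 b4 + 5 * (a4.toNat + b4.toNat) := by
  decide +kernel

/-- Adding up `cutPotential_step` around the cycle. -/
lemma three_mul_le_of_window {n : ℕ} [NeZero n] (a b : ZMod n → Bool)
    (ha : ∀ i, (a i || a (i - 1) || a (i + 1) || b i) = true)
    (hb : ∀ i, (b i || a i || b (i - 2) || b (i + 2)) = true) :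
    3 * n ≤ 5 * ∑ i, ((a i).toNat + (b i).toNat) := by
  set f : ZMod n → ℕ := fun i =>
    cutPotential (a (i - 1)) (a i) (b (i - 3)) (b (i - 2)) (b (i - 1)) (b i) with hf
  have step (i : ZMod n) :
      3 + f i ≤ f (i + 1) + 5 * ((a (i + 1)).toNat + (b (i + 1)).toNat) := by
    have h := hb (i - 1)
    rw [show i - 1 - 2 = i - 3 by ring, show i - 1 + 2 = i + 1 by ring] at h
    have := cutPotential_step _ _ _ _ (b (i - 2)) _ _ _ (ha i) h
    simp only [hf]
    rwa [show i + 1 - 1 = i by ring, show i + 1 - 3 = i - 2 by ring,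
      show i + 1 - 2 = i - 1 by ring]
  have shift (g : ZMod n → ℕ) : ∑ i, g (i + 1) = ∑ i, g i :=
    Equiv.sum_comp (Equiv.addRight (1 : ZMod n)) g
  have h := Finset.sum_le_sum fun i (_ : i ∈ Finset.univ) => step i
  rw [Finset.sum_add_distrib, Finset.sum_add_distrib, ← Finset.mul_sum, shift f,
    shift fun i => (a i).toNat + (b i).toNat] at h
  simp only [Finset.sum_const, Finset.card_univ, ZMod.card, smul_eq_mul] at h
  omega

lemma P2_adj_uV {n : ℕ} {x : PVert n} {i : ZMod n} (h : (P2 n).Adj x (uV i)) :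
    x = uV (i - 1) ∨ x = uV (i + 1) ∨ x = vV i := by
  simp only [P2, SimpleGraph.fromRel_adj, uV, vV] at h ⊢
  grind

lemma P2_adj_vV {n : ℕ} {x : PVert n} {i : ZMod n} (h : (P2 n).Adj x (vV i)) :
    x = uV i ∨ x = vV (i - 2) ∨ x = vV (i + 2) := by
  simp only [P2, SimpleGraph.fromRel_adj, uV, vV] at h ⊢
  grind

lemma three_mul_le_ncard {n : ℕ} [NeZero n] {S : Set (PVert n)} (hS : IsDomSet (P2 n) S) :
    3 * n ≤ 5 * S.ncard := by
  classical
  have key := three_mul_le_of_window (fun i => decide (uV i ∈ S)) (fun i => decide (vV i ∈ S))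
    (fun i => by
      have := hS (uV i)
      have := fun x => P2_adj_uV (x := x) (i := i)
      simp only [Bool.or_eq_true, decide_eq_true_eq]
      grind)
    (fun i => by
      have := hS (vV i)
      have := fun x => P2_adj_vV (x := x) (i := i)
      simp only [Bool.or_eq_true, decide_eq_true_eq]
      grind)
  have hcard : S.ncard = ∑ i : ZMod n,
      ((decide (uV i ∈ S)).toNat + (decide (vV i ∈ S)).toNat) := by
    rw [Set.ncard_eq_toFinset_card', Finset.sum_add_distrib, ← Set.filter_mem_univ_eq_toFinset,
      Finset.card_filter, Fintype.sum_sum_type]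
    have toNat_decide (p : Prop) [Decidable p] : (decide p).toNat = if p then 1 else 0 := by
      by_cases hp : p <;> simp [hp]
    simp only [toNat_decide]
    rfl
  rwa [hcard]

/-- The outer vertices with index `k ≡ 1, 3 [MOD 5]` together with, when `n ≡ 1, 2 [MOD 5]`, those
in the incomplete last period. -/
def outerChosen (n k : ℕ) : Prop :=
  k % 5 = 1 ∨ k % 5 = 3 ∨ (k % 5 = 0 ∧ n ≤ k + 2)

instance (n : ℕ) : DecidablePred (outerChosen n) := fun _ =>
  inferInstanceAs (Decidable (_ ∨ _))

/-- A dominating set of `P(n,2)` with `⌈3n/5⌉` elements. -/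
def smallDomSet (n : ℕ) : Finset (PVert n) :=
  ((Finset.range n).filter (outerChosen n)).image (fun k : ℕ => uV (k : ZMod n)) ∪
    ((Finset.range n).filter (· % 5 = 2)).image (fun k : ℕ => vV (k : ZMod n))

lemma card_smallDomSet_le (n : ℕ) : 5 * (smallDomSet n).card ≤ 3 * n + 4 := by
  have h1 : (smallDomSet n).card ≤ n.count (outerChosen n) + n.count (· % 5 = 2) := by
    simp only [Nat.count_eq_card_filter_range]
    exact (Finset.card_union_le _ _).trans
      (add_le_add Finset.card_image_le Finset.card_image_le)
  have h2 (q : ℕ) : (5 * q).count (· % 5 = 2) = q := by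
    induction q with
    | zero => rfl
    | succ q ih =>
      simp [mul_add, Nat.count_succ, ih, Nat.add_mod]
  have h3 (q : ℕ) (hq : 5 * q ≤ n) : (5 * q).count (outerChosen n) = 2 * q := by
    induction q with
    | zero => rfl
    | succ q ih =>
      have : ¬ n ≤ 5 * q + 2 := by omega
      simp [mul_add, Nat.count_succ, ih (by omega), Nat.add_mod, outerChosen, this]
  have h4 := h2 (n / 5)
  have h5 := h3 (n / 5) (by omega)
  have h6 : n % 5 < 5 := Nat.mod_lt _ (by norm_num)
  obtain ⟨q, r, hn, hq, hr⟩ : ∃ q r, n = 5 * q + r ∧ n / 5 = q ∧ n % 5 = r :=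
    ⟨_, _, (Nat.div_add_mod n 5).symm, rfl, rfl⟩
  rw [hq] at h4 h5
  rw [hr] at h6
  have h7 : n.count (outerChosen n) + n.count (· % 5 = 2) =
      (5 * q + r).count (outerChosen n) + (5 * q + r).count (· % 5 = 2) := by rw [← hn]
  interval_cases r <;>
    simp [Nat.count_succ, outerChosen, h4, Nat.add_mod] at h7 h5 <;> grind

lemma natCast_zmod_ne_zero {n m : ℕ} (hm : 0 < m) (hmn : m < n) : (m : ZMod n) ≠ 0 := fun h =>
  (Nat.le_of_dvd hm ((ZMod.natCast_eq_zero_iff m n).1 h)).not_gt hmn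

lemma P2_adj_uV_vV {n : ℕ} (i : ZMod n) : (P2 n).Adj (uV i) (vV i) := by
  simp [P2, uV, vV]

lemma P2_adj_uV_succ {n : ℕ} (hn : 3 ≤ n) (i : ZMod n) : (P2 n).Adj (uV i) (uV (i + 1)) := by
  have : (1 : ZMod n) ≠ 0 := by
    exact_mod_cast natCast_zmod_ne_zero (n := n) one_pos (by omega)
  simp [P2, uV, vV, this]

lemma P2_adj_vV_add_two {n : ℕ} (hn : 3 ≤ n) (i : ZMod n) : (P2 n).Adj (vV i) (vV (i + 2)) := by
  have : (2 : ZMod n) ≠ 0 := by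
    exact_mod_cast natCast_zmod_ne_zero (n := n) two_pos (by omega)
  simp [P2, uV, vV, this]

lemma isDomSet_smallDomSet {n : ℕ} (hn : 3 ≤ n) : IsDomSet (P2 n) (smallDomSet n) := by
  have : NeZero n := ⟨by omega⟩
  have memU {k : ℕ} (hk : k < n) (h : outerChosen n k) :
      uV (k : ZMod n) ∈ (smallDomSet n : Set (PVert n)) :=
    Finset.mem_union_left _ (Finset.mem_image.2 ⟨k, by simp [hk, h], rfl⟩)
  have memV {k : ℕ} (hk : k < n) (h : k % 5 = 2) :
      vV (k : ZMod n) ∈ (smallDomSet n : Set (PVert n)) :=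
    Finset.mem_union_right _ (Finset.mem_image.2 ⟨k, by simp [hk, h], rfl⟩)
  have adjU (k : ℕ) : (P2 n).Adj (uV (k : ZMod n)) (uV ((k + 1 : ℕ) : ZMod n)) := by
    simpa using P2_adj_uV_succ hn k
  have adjV (k : ℕ) : (P2 n).Adj (vV (k : ZMod n)) (vV ((k + 2 : ℕ) : ZMod n)) := by
    simpa using P2_adj_vV_add_two hn k
  rintro (i | i)
  · change uV i ∈ _ ∨ ∃ x ∈ _, (P2 n).Adj x (uV i)
    obtain ⟨k, hk, rfl⟩ : ∃ k < n, (k : ZMod n) = i := ⟨i.val, i.val_lt, i.natCast_zmod_val⟩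
    by_cases h : outerChosen n k
    · exact .inl (memU hk h)
    right
    simp only [outerChosen] at h
    obtain h0 | h2 | h4 : k % 5 = 0 ∨ k % 5 = 2 ∨ k % 5 = 4 := by omega
    · exact ⟨_, memU (k := k + 1) (by omega) (by simp only [outerChosen]; omega), (adjU k).symm⟩
    · exact ⟨_, memV hk h2, (P2_adj_uV_vV _).symm⟩
    · obtain ⟨j, rfl⟩ : ∃ j, k = j + 1 := ⟨k - 1, by omega⟩
      exact ⟨_, memU (k := j) (by omega) (by simp only [outerChosen]; omega), adjU j⟩
  · change vV i ∈ _ ∨ ∃ x ∈ _, (P2 n).Adj x (vV i)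
    obtain ⟨k, hk, rfl⟩ : ∃ k < n, (k : ZMod n) = i := ⟨i.val, i.val_lt, i.natCast_zmod_val⟩
    by_cases h : outerChosen n k
    · exact .inr ⟨_, memU hk h, P2_adj_uV_vV _⟩
    simp only [outerChosen] at h
    obtain h0 | h2 | h4 : k % 5 = 0 ∨ k % 5 = 2 ∨ k % 5 = 4 := by omega
    · exact .inr ⟨_, memV (k := k + 2) (by omega) (by omega), (adjV k).symm⟩
    · exact .inl (memV hk h2)
    · obtain ⟨j, rfl⟩ : ∃ j, k = j + 2 := ⟨k - 2, by omega⟩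
      exact .inr ⟨_, memV (k := j) (by omega) (by omega), adjV j⟩

/-- For every integer `n ≥ 3`, the domination number of the
generalized Petersen graph `P(n,2)` equals `⌈3n/5⌉`. -/
theorem domNum_P2 (n : ℕ) (hn : 3 ≤ n) :
    domNum (P2 n) = ceil35 n := by
  have : NeZero n := ⟨by omega⟩
  have hmem : (smallDomSet n).card ∈
      {k | ∃ S : Set (PVert n), IsDomSet (P2 n) S ∧ S.ncard = k} :=
    ⟨_, isDomSet_smallDomSet hn, Set.ncard_coe_finset _⟩
  apply le_antisymm
  · have h1 : domNum (P2 n) ≤ (smallDomSet n).card := Nat.sInf_le hmem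
    have h2 := card_smallDomSet_le n
    have h3 : (3 * (n : ℚ)) / 5 ≤ ceil35 n := Nat.le_ceil _
    have h4 : 3 * n ≤ 5 * ceil35 n := by
      rw [div_le_iff₀ (by norm_num)] at h3
      have : 3 * n ≤ ceil35 n * 5 := by exact_mod_cast h3
      omega
    omega
  · obtain ⟨S, hS, hk⟩ := Nat.sInf_mem ⟨_, hmem⟩
    have h1 := three_mul_le_ncard hS
    rw [hk] at h1
    refine Nat.ceil_le.2 ?_
    rw [div_le_iff₀ (by norm_num)]
    rw [mul_comm 5] at h1
    exact_mod_cast h1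

end PetersenDom
end

section
/- Let n ≥ 10, let f ∈ ℤ/nℤ, and let S be a dominating set of P_f(n,2). If for some i ∈ ℤ/nℤ we have u_i ∉ S (with u_i ≠ u_f) and u_f ∉ M_i = {u_{i−1}, v_i, u_{i+1}}, then γ_i(S) = |B_i ∩ S| ≥ 3. -/
namespace PetersenDom

/-- The neighbours of the outer vertex `u_j`. -/
lemma eq_of_adj_uV {n : ℕ} {j : ZMod n} {w : PVert n} (h : (P2 n).Adj w (uV j)) :
    w = uV (j - 1) ∨ w = uV (j + 1) ∨ w = vV j := by
  rw [P2, SimpleGraph.fromRel_adj] at h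
  rcases h with ⟨-, (⟨k, rfl, hk⟩ | ⟨k, rfl, hk⟩ | ⟨k, rfl, hk⟩) |
    (⟨k, hk, rfl⟩ | ⟨k, hk, rfl⟩ | ⟨k, hk, rfl⟩)⟩ <;> simp_all [uV, vV]

/-- The neighbours of the inner vertex `v_j`. -/
lemma eq_of_adj_vV {n : ℕ} {j : ZMod n} {w : PVert n} (h : (P2 n).Adj w (vV j)) :
    w = vV (j - 2) ∨ w = vV (j + 2) ∨ w = uV j := by
  rw [P2, SimpleGraph.fromRel_adj] at h
  rcases h with ⟨-, (⟨k, rfl, hk⟩ | ⟨k, rfl, hk⟩ | ⟨k, rfl, hk⟩) |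
    (⟨k, hk, rfl⟩ | ⟨k, hk, rfl⟩ | ⟨k, hk, rfl⟩)⟩ <;> simp_all [uV, vV]

lemma natCast_ne_zero_of_lt {n k : ℕ} (hk : 0 < k) (hkn : k < n) : (k : ZMod n) ≠ 0 := by
  rw [Ne, ZMod.natCast_eq_zero_iff]
  exact Nat.not_dvd_of_pos_of_lt hk hkn

/-- if `u_i ∉ S` (with `u_i ≠ u_f`) and `u_f ∉ M_i`, then
`γ_i(S) ≥ 3` for any dominating set `S` of `P_f(n,2)`. -/
theorem gam_ge_three (n : ℕ) (hn : 10 ≤ n) (f : ZMod n) (S : Set (PVert n))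
    (hS : IsDomSetF n f S) (i : ZMod n) (hui : uV i ∉ S)
    (hif : uV (n := n) i ≠ uV f) (hM : uV f ∉ Mset n i) :
    3 ≤ gam n i S := by
  have h1 : (1 : ZMod n) ≠ 0 := mod_cast natCast_ne_zero_of_lt (k := 1) (by omega) (by omega)
  have h2 : (2 : ZMod n) ≠ 0 := mod_cast natCast_ne_zero_of_lt (k := 2) (by omega) (by omega)
  have h3 : (3 : ZMod n) ≠ 0 := mod_cast natCast_ne_zero_of_lt (k := 3) (by omega) (by omega)
  have h4 : (4 : ZMod n) ≠ 0 := mod_cast natCast_ne_zero_of_lt (k := 4) (by omega) (by omega)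
  obtain ⟨-, hdom⟩ := hS
  simp only [Mset, Set.mem_insert_iff, Set.mem_singleton_iff, not_or] at hM
  obtain ⟨hl, -, hr⟩ := hM
  obtain ⟨a, haS, ha⟩ : ∃ a ∈ S, a = uV (i - 2) ∨ a = uV (i - 1) ∨ a = vV (i - 1) := by
    rcases hdom (uV (i - 1)) (Ne.symm hl) with h | ⟨w, hw, hadj⟩
    · exact ⟨_, h, by simp⟩
    · rcases eq_of_adj_uV hadj with rfl | rfl | rfl
      · exact ⟨_, hw, Or.inl (congrArg uV (by ring))⟩
      · exact absurd (by simpa using hw) hui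
      · exact ⟨_, hw, by simp⟩
  obtain ⟨b, hbS, hb⟩ : ∃ b ∈ S, b = vV (i - 2) ∨ b = vV i ∨ b = vV (i + 2) := by
    rcases hdom (vV i) (by simp [uV, vV]) with h | ⟨w, hw, hadj⟩
    · exact ⟨_, h, by simp⟩
    · rcases eq_of_adj_vV hadj with rfl | rfl | rfl
      · exact ⟨_, hw, by simp⟩
      · exact ⟨_, hw, by simp⟩
      · exact absurd hw hui
  obtain ⟨c, hcS, hc⟩ : ∃ c ∈ S, c = uV (i + 2) ∨ c = uV (i + 1) ∨ c = vV (i + 1) := by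
    rcases hdom (uV (i + 1)) (Ne.symm hr) with h | ⟨w, hw, hadj⟩
    · exact ⟨_, h, by simp⟩
    · rcases eq_of_adj_uV hadj with rfl | rfl | rfl
      · exact absurd (by simpa using hw) hui
      · exact ⟨_, hw, Or.inl (congrArg uV (by ring))⟩
      · exact ⟨_, hw, by simp⟩
  have hab : a ≠ b := by
    rcases ha with rfl | rfl | rfl <;> rcases hb with rfl | rfl | rfl <;>
      simp only [uV, vV, ne_eq, Sum.inr.injEq, reduceCtorEq, not_false_eq_true] <;>
      intro h
    · exact h1 (by linear_combination h)
    · exact h1 (by linear_combination -h)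
    · exact h3 (by linear_combination -h)
  have hac : a ≠ c := by
    rcases ha with rfl | rfl | rfl <;> rcases hc with rfl | rfl | rfl <;>
      simp only [uV, vV, ne_eq, Sum.inl.injEq, Sum.inr.injEq, reduceCtorEq, not_false_eq_true] <;>
      intro h
    · exact h4 (by linear_combination -h)
    · exact h3 (by linear_combination -h)
    · exact h3 (by linear_combination -h)
    · exact h2 (by linear_combination -h)
    · exact h2 (by linear_combination -h)
  have hbc : b ≠ c := by
    rcases hb with rfl | rfl | rfl <;> rcases hc with rfl | rfl | rfl <;>
      simp only [uV, vV, ne_eq, Sum.inr.injEq, reduceCtorEq, not_false_eq_true] <;>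
      intro h
    · exact h3 (by linear_combination -h)
    · exact h1 (by linear_combination -h)
    · exact h1 (by linear_combination h)
  have hsub : ({a, b, c} : Set (PVert n)) ⊆ Blk n i ∩ S := by
    rintro x (rfl | rfl | rfl)
    · exact ⟨by rcases ha with rfl | rfl | rfl <;> simp [Blk], haS⟩
    · exact ⟨by rcases hb with rfl | rfl | rfl <;> simp [Blk], hbS⟩
    · exact ⟨by rcases hc with rfl | rfl | rfl <;> simp [Blk], hcS⟩
  have hfin : (Blk n i ∩ S).Finite :=
    Set.Finite.subset (by simp [Blk]) Set.inter_subset_left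
  have hcard : ({a, b, c} : Set (PVert n)).ncard = 3 :=
    Set.ncard_eq_three.mpr ⟨a, b, c, hab, hac, hbc, rfl⟩
  exact hcard ▸ Set.ncard_le_ncard hsub hfin

end PetersenDom
end

section
/- Let n ≥ 11 and f ∈ ℤ/nℤ. If there exists a minimum dominating set S of P_f(n,2) with N(u_f) ∩ S = ∅, then there exists a minimum dominating set S' of P_f(n,2) with N(u_f) ∩ S' = ∅ and γ_i(S') ≥ 2 for all i ∈ ℤ/nℤ. -/
namespace PetersenDom

/-- `e` is a direction of travel around the cycle, `1` or `-1`; stating the lemmas below for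
an arbitrary direction covers each configuration together with its mirror image. -/
def IsDir {n : ℕ} (e : ZMod n) : Prop := e = 1 ∨ e = -1

lemma small_ne_zero {n : ℕ} (hn : 11 ≤ n) :
    (1 : ZMod n) ≠ 0 ∧ (2 : ZMod n) ≠ 0 ∧ (3 : ZMod n) ≠ 0 ∧ (4 : ZMod n) ≠ 0 ∧
      (5 : ZMod n) ≠ 0 ∧ (6 : ZMod n) ≠ 0 := by
  have key : ∀ k : ℕ, 0 < k → k < 11 → (k : ZMod n) ≠ 0 := fun k hk hkn =>
    natCast_ne_zero_of_lt hk (hkn.trans_le hn)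
  exact ⟨by simpa using key 1, by simpa using key 2, by simpa using key 3,
    by simpa using key 4, by simpa using key 5, by simpa using key 6⟩

@[simp] lemma uV_inj {n : ℕ} {a b : ZMod n} : (uV a : PVert n) = uV b ↔ a = b :=
  Sum.inl_injective.eq_iff

@[simp] lemma vV_inj {n : ℕ} {a b : ZMod n} : (vV a : PVert n) = vV b ↔ a = b :=
  Sum.inr_injective.eq_iff

@[simp] lemma uV_ne_vV {n : ℕ} {a b : ZMod n} : (uV a : PVert n) ≠ vV b := Sum.inl_ne_inr

@[simp] lemma vV_ne_uV {n : ℕ} {a b : ZMod n} : (vV a : PVert n) ≠ uV b := Sum.inr_ne_inl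

lemma exists_adj_uV_iff {n : ℕ} (hn : 11 ≤ n) {S : Set (PVert n)} {a : ZMod n} :
    (∃ u ∈ S, (P2 n).Adj u (uV a)) ↔ uV (a + 1) ∈ S ∨ uV (a - 1) ∈ S ∨ vV a ∈ S := by
  obtain ⟨h1, -⟩ := small_ne_zero hn
  constructor
  · rintro ⟨u, hu, -, h⟩
    simp only [uV_inj, uV_ne_vV, false_and, and_false, exists_false, or_false] at h
    grind
  · rintro (h | h | h)
    · exact ⟨_, h, by simpa using h1, .inr (.inl ⟨a, rfl, rfl⟩)⟩
    · exact ⟨_, h, by simpa using h1, .inl (.inl ⟨a - 1, rfl, by simp⟩)⟩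
    · exact ⟨_, h, vV_ne_uV, .inr (.inr (.inl ⟨a, rfl, rfl⟩))⟩

lemma exists_adj_vV_iff {n : ℕ} (hn : 11 ≤ n) {S : Set (PVert n)} {a : ZMod n} :
    (∃ u ∈ S, (P2 n).Adj u (vV a)) ↔ vV (a + 2) ∈ S ∨ vV (a - 2) ∈ S ∨ uV a ∈ S := by
  obtain ⟨-, h2, -⟩ := small_ne_zero hn
  constructor
  · rintro ⟨u, hu, -, h⟩
    simp only [vV_inj, vV_ne_uV, false_and, and_false, exists_false, false_or] at h
    grind
  · rintro (h | h | h)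
    · exact ⟨_, h, by simpa using h2, .inr (.inr (.inr ⟨a, rfl, rfl⟩))⟩
    · exact ⟨_, h, by simpa using h2, .inl (.inr (.inr ⟨a - 2, rfl, by simp⟩))⟩
    · exact ⟨_, h, uV_ne_vV, .inl (.inr (.inl ⟨a, rfl, rfl⟩))⟩

/-- Domination of `P_f(n,2)` in coordinates, read in the direction `e`. -/
lemma isDomSetF_iff {n : ℕ} (hn : 11 ≤ n) {f e : ZMod n} (he : IsDir e) {S : Set (PVert n)} :
    IsDomSetF n f S ↔ uV f ∉ S ∧
      (∀ a, a ≠ f → uV a ∈ S ∨ uV (a + e) ∈ S ∨ uV (a - e) ∈ S ∨ vV a ∈ S) ∧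
      ∀ a, vV a ∈ S ∨ vV (a + 2 * e) ∈ S ∨ vV (a - 2 * e) ∈ S ∨ uV a ∈ S := by
  have key : IsDomSetF n f S ↔ uV f ∉ S ∧
      (∀ a, a ≠ f → uV a ∈ S ∨ uV (a + 1) ∈ S ∨ uV (a - 1) ∈ S ∨ vV a ∈ S) ∧
      ∀ a, vV a ∈ S ∨ vV (a + 2) ∈ S ∨ vV (a - 2) ∈ S ∨ uV a ∈ S := by
    refine and_congr_right fun _ => ⟨fun h => ⟨fun a ha => ?_, fun a => ?_⟩, fun h v hv => ?_⟩
    · exact (h (uV a) (by simpa using ha)).imp_right (exists_adj_uV_iff hn).1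
    · exact (h (vV a) vV_ne_uV).imp_right (exists_adj_vV_iff hn).1
    · rcases v with a | a
      · exact (h.1 a (by rintro rfl; exact hv rfl)).imp_right (exists_adj_uV_iff hn).2
      · exact (h.2 a).imp_right (exists_adj_vV_iff hn).2
  rw [key]
  rcases he with rfl | rfl
  · simp only [mul_one]
  · simp only [mul_neg, mul_one, sub_neg_eq_add, ← sub_eq_add_neg]
    grind

lemma uV_mem_Blk {n : ℕ} {e : ZMod n} (he : IsDir e) {a i : ZMod n} :
    uV a ∈ Blk n i ↔
      a = i - 2 * e ∨ a = i - e ∨ a = i ∨ a = i + e ∨ a = i + 2 * e := by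
  simp only [Blk, Set.mem_insert_iff, Set.mem_singleton_iff, uV_inj, uV_ne_vV, or_false]
  rcases he with rfl | rfl <;> grind

lemma vV_mem_Blk {n : ℕ} {e : ZMod n} (he : IsDir e) {a i : ZMod n} :
    vV a ∈ Blk n i ↔
      a = i - 2 * e ∨ a = i - e ∨ a = i ∨ a = i + e ∨ a = i + 2 * e := by
  simp only [Blk, Set.mem_insert_iff, Set.mem_singleton_iff, vV_inj, vV_ne_uV, false_or]
  rcases he with rfl | rfl <;> grind

lemma two_le_gam_iff {n : ℕ} {i : ZMod n} {S : Set (PVert n)} :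
    2 ≤ gam n i S ↔ (Blk n i ∩ S).Nontrivial := by
  have hfin : (Blk n i ∩ S).Finite := by
    refine Set.Finite.subset ?_ Set.inter_subset_left
    unfold Blk
    exact Set.toFinite _
  have := hfin.to_subtype
  exact Set.one_lt_ncard_iff_nontrivial

lemma IsDir.neg {n : ℕ} {e : ZMod n} (he : IsDir e) : IsDir (-e) := by
  rcases he with rfl | rfl
  · exact .inr rfl
  · exact .inl (neg_neg 1)

lemma nbr_inter_eq_empty_iff {n : ℕ} {f e : ZMod n} (he : IsDir e) {S : Set (PVert n)} :
    Nbr n f ∩ S = ∅ ↔ uV (f - e) ∉ S ∧ uV (f + e) ∉ S ∧ vV f ∉ S := by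
  rw [← Set.disjoint_iff_inter_eq_empty, Nbr]
  rcases he with rfl | rfl <;>
    simp only [Set.disjoint_insert_left, Set.disjoint_singleton_left, sub_neg_eq_add,
      ← sub_eq_add_neg]
  tauto

/-- Reading in coordinates of `γ_i(S) ≤ 1`. -/
lemma eq_of_gam_lt_two {n : ℕ} {i : ZMod n} {S : Set (PVert n)}
    (h : ¬2 ≤ gam n i S) :
    (∀ a b, uV a ∈ Blk n i → uV b ∈ Blk n i → uV a ∈ S → uV b ∈ S → a = b) ∧
      (∀ a b, vV a ∈ Blk n i → vV b ∈ Blk n i → vV a ∈ S → vV b ∈ S → a = b) ∧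
      ∀ a b, uV a ∈ Blk n i → vV b ∈ Blk n i → uV a ∈ S → vV b ∉ S := by
  rw [two_le_gam_iff, Set.not_nontrivial_iff] at h
  exact ⟨fun a b ha hb hSa hSb => uV_inj.1 (h ⟨ha, hSa⟩ ⟨hb, hSb⟩),
    fun a b ha hb hSa hSb => vV_inj.1 (h ⟨ha, hSa⟩ ⟨hb, hSb⟩),
    fun a b ha hb hSa hSb => uV_ne_vV (h ⟨ha, hSa⟩ ⟨hb, hSb⟩)⟩

lemma dir_ne_zero {n : ℕ} (hn : 11 ≤ n) {e : ZMod n} (he : IsDir e) :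
    e ≠ 0 ∧ 2 * e ≠ 0 ∧ 3 * e ≠ 0 ∧ 4 * e ≠ 0 ∧ 5 * e ≠ 0 ∧ 6 * e ≠ 0 := by
  rcases he with rfl | rfl <;> simpa using small_ne_zero hn

lemma uV_mem_of_gam_lt_two {n : ℕ} (hn : 11 ≤ n) {f i e : ZMod n} (he : IsDir e)
    {S : Set (PVert n)} (hS : IsDomSetF n f S) (hi : ¬2 ≤ gam n i S)
    (h0 : i ≠ f) (h1 : i + e ≠ f) (h2 : i - e ≠ f) : uV i ∈ S := by
  obtain ⟨e1, e2, e3, e4, -⟩ := dir_ne_zero hn he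
  obtain ⟨-, hu, hv⟩ := (isDomSetF_iff hn he).1 hS
  obtain ⟨uu, vv, uv⟩ := eq_of_gam_lt_two hi
  simp only [uV_mem_Blk he, vV_mem_Blk he] at uu vv uv
  have du := hu i h0
  have dr := hu _ h1
  have dl := hu _ h2
  grind

/-- The neighbourhood of a block that contains a single vertex of `S`. -/
lemma pattern_of_gam_lt_two {n : ℕ} (hn : 11 ≤ n) {f i e : ZMod n} (he : IsDir e)
    {S : Set (PVert n)} (hS : IsDomSetF n f S) (hi : ¬2 ≤ gam n i S) (hu : uV i ∈ S)
    (h2 : i + 2 * e ≠ f) :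
    uV (i + 2 * e) ∉ S ∧ uV (i + 3 * e) ∈ S ∧ vV (i + 3 * e) ∈ S ∧ vV (i + 4 * e) ∈ S := by
  obtain ⟨e1, e2, -⟩ := dir_ne_zero hn he
  obtain ⟨-, hdu, hdv⟩ := (isDomSetF_iff hn he).1 hS
  obtain ⟨uu, -, uv⟩ := eq_of_gam_lt_two hi
  have hi_mem : uV i ∈ Blk n i := by simp [uV_mem_Blk he]
  have no_u : ∀ a, a - i ≠ 0 → uV a ∈ Blk n i → uV a ∉ S := fun a ha hB hSa =>
    ha (sub_eq_zero.2 (uu a i hB hi_mem hSa hu))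
  have no_v : ∀ a, vV a ∈ Blk n i → vV a ∉ S := fun a hB => uv i a hi_mem hB hu
  have u1 : uV (i + e) ∉ S := no_u _ (by simpa using e1) (by simp [uV_mem_Blk he])
  have u2 : uV (i + 2 * e) ∉ S := no_u _ (by simpa using e2) (by simp [uV_mem_Blk he])
  have v1 : vV (i + e) ∉ S := no_v _ (by simp [vV_mem_Blk he])
  have v2 : vV (i + 2 * e) ∉ S := no_v _ (by simp [vV_mem_Blk he])
  have v0 : vV i ∉ S := no_v _ (by simp [vV_mem_Blk he])
  have v_1 : vV (i - e) ∉ S := no_v _ (by simp [vV_mem_Blk he])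
  have d1 := hdv (i + e)
  have d2 := hdu _ h2
  have d3 := hdv (i + 2 * e)
  rw [show i + e + 2 * e = i + 3 * e by ring, show i + e - 2 * e = i - e by ring] at d1
  rw [show i + 2 * e + e = i + 3 * e by ring, show i + 2 * e - e = i + e by ring] at d2
  rw [show i + 2 * e + 2 * e = i + 4 * e by ring, show i + 2 * e - 2 * e = i by ring] at d3
  tauto

lemma two_le_gam_center {n : ℕ} (hn : 11 ≤ n) {f : ZMod n} {S : Set (PVert n)}
    (hS : IsDomSetF n f S) (hN : Nbr n f ∩ S = ∅) : 2 ≤ gam n f S := by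
  have he : IsDir (1 : ZMod n) := .inl rfl
  obtain ⟨e1, e2, -, e4, -⟩ := small_ne_zero hn
  obtain ⟨hf, hdu, -⟩ := (isDomSetF_iff hn he).1 hS
  obtain ⟨nl, nr, -⟩ := (nbr_inter_eq_empty_iff he).1 hN
  by_contra hi
  obtain ⟨uu, vv, uv⟩ := eq_of_gam_lt_two hi
  have d1 := hdu (f + 1) (by simpa using e1)
  have d2 := hdu (f - 1) (by simpa using e1)
  rw [show f + 1 + 1 = f + 2 by ring, show f + 1 - 1 = f by ring] at d1
  rw [show f - 1 + 1 = f by ring, show f - 1 - 1 = f - 2 by ring] at d2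
  have a := uu (f + 2) (f - 2) (by simp [uV_mem_Blk he]) (by simp [uV_mem_Blk he])
  have b := uv (f + 2) (f - 1) (by simp [uV_mem_Blk he]) (by simp [vV_mem_Blk he])
  have c := uv (f - 2) (f + 1) (by simp [uV_mem_Blk he]) (by simp [vV_mem_Blk he])
  have d := vv (f + 1) (f - 1) (by simp [vV_mem_Blk he]) (by simp [vV_mem_Blk he])
  have a' : f + 2 ≠ f - 2 := fun h => e4 (by linear_combination h)
  have d' : f + 1 ≠ f - 1 := fun h => e2 (by linear_combination h)
  tauto

lemma two_le_gam_side {n : ℕ} (hn : 11 ≤ n) {f e : ZMod n} (he : IsDir e) {S : Set (PVert n)}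
    (hS : IsDomSetF n f S) (hN : Nbr n f ∩ S = ∅) : 2 ≤ gam n (f + e) S := by
  obtain ⟨e1, e2, -⟩ := dir_ne_zero hn he
  obtain ⟨hf, hdu, hdv⟩ := (isDomSetF_iff hn he).1 hS
  obtain ⟨-, nr, -⟩ := (nbr_inter_eq_empty_iff he).1 hN
  by_contra hi
  obtain ⟨uu, vv, uv⟩ := eq_of_gam_lt_two hi
  have d1 := hdu (f + e) (by simpa using e1)
  have d2 := hdu (f + 2 * e) (by simpa using e2)
  have d3 := hdv (f + e)
  rw [show f + e + e = f + 2 * e by ring, show f + e - e = f by ring] at d1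
  rw [show f + 2 * e + e = f + 3 * e by ring, show f + 2 * e - e = f + e by ring] at d2
  rw [show f + e + 2 * e = f + 3 * e by ring, show f + e - 2 * e = f - e by ring] at d3
  have mu2 : uV (f + 2 * e) ∈ Blk n (f + e) := by rw [uV_mem_Blk he]; grind
  have mu3 : uV (f + 3 * e) ∈ Blk n (f + e) := by rw [uV_mem_Blk he]; grind
  have mv1 : vV (f + e) ∈ Blk n (f + e) := by rw [vV_mem_Blk he]; grind
  have mv2 : vV (f + 2 * e) ∈ Blk n (f + e) := by rw [vV_mem_Blk he]; grind
  have mv3 : vV (f + 3 * e) ∈ Blk n (f + e) := by rw [vV_mem_Blk he]; grind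
  have mv_1 : vV (f - e) ∈ Blk n (f + e) := by rw [vV_mem_Blk he]; grind
  have a1 := uv _ _ mu2 mv1
  have a2 := uv _ _ mu2 mv3
  have a3 := uv _ _ mu2 mv_1
  have a4 := uv _ _ mu3 mv1
  have a5 := vv _ _ mv1 mv2
  have a6 : f + e ≠ f + 2 * e := fun h => e1 (by linear_combination -h)
  rcases d1 with h | h | h | h
  · exact nr h
  · rcases d3 with h' | h' | h' | h'
    exacts [a1 h h', a2 h h', a3 h h', nr h']
  · exact hf h
  · rcases d2 with h' | h' | h' | h'
    exacts [a1 h' h, a4 h' h, nr h', a6 (a5 h h')]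

/-- The set obtained from `S` by moving `u_{i+3e}` one step towards `u_i`. -/
def shift {n : ℕ} (S : Set (PVert n)) (i e : ZMod n) : Set (PVert n) :=
  insert (uV (i + 2 * e)) (S \ {uV (i + 3 * e)})

lemma vV_mem_shift {n : ℕ} {S : Set (PVert n)} {i e a : ZMod n} :
    vV a ∈ shift S i e ↔ vV a ∈ S := by
  simp [shift]

lemma uV_mem_shift {n : ℕ} {S : Set (PVert n)} {i e a : ZMod n} :
    uV a ∈ shift S i e ↔ a = i + 2 * e ∨ (uV a ∈ S ∧ a ≠ i + 3 * e) := by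
  simp [shift]

lemma isDomSetF_shift {n : ℕ} (hn : 11 ≤ n) {f i e : ZMod n} (he : IsDir e)
    {S : Set (PVert n)} (hS : IsDomSetF n f S) (h2 : i + 2 * e ≠ f)
    (hv3 : vV (i + 3 * e) ∈ S) (hv4 : vV (i + 4 * e) ∈ S) : IsDomSetF n f (shift S i e) := by
  obtain ⟨hf, hdu, hdv⟩ := (isDomSetF_iff hn he).1 hS
  rw [isDomSetF_iff hn he]
  simp only [uV_mem_shift, vV_mem_shift]
  refine ⟨by tauto, fun a ha => ?_, fun a => ?_⟩
  · by_cases h3 : a = i + 3 * e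
    · subst h3; tauto
    by_cases h4 : a = i + 4 * e
    · subst h4; tauto
    by_cases h5 : a = i + 2 * e
    · tauto
    have p : a + e ≠ i + 3 * e := fun h => h5 (by linear_combination h)
    have q : a - e ≠ i + 3 * e := fun h => h4 (by linear_combination h)
    have := hdu a ha
    tauto
  · by_cases h3 : a = i + 3 * e
    · subst h3; tauto
    have := hdv a
    tauto

lemma two_le_gam_shift {n : ℕ} (hn : 11 ≤ n) {i j e : ZMod n} (he : IsDir e)
    {S : Set (PVert n)} (hu2 : uV (i + 2 * e) ∉ S)
    (hv3 : vV (i + 3 * e) ∈ S) (hv4 : vV (i + 4 * e) ∈ S) (hj : 2 ≤ gam n j S) :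
    2 ≤ gam n j (shift S i e) := by
  obtain ⟨e1, -⟩ := dir_ne_zero hn he
  rw [two_le_gam_iff] at hj ⊢
  by_cases h5 : j = i + 5 * e
  · refine ⟨vV (i + 3 * e), ⟨?_, vV_mem_shift.2 hv3⟩, vV (i + 4 * e), ⟨?_, vV_mem_shift.2 hv4⟩,
      ?_⟩
    · rw [vV_mem_Blk he]; grind
    · rw [vV_mem_Blk he]; grind
    · rw [Ne, vV_inj]; exact fun h => e1 (by linear_combination -h)
  · by_cases h3 : uV (i + 3 * e) ∈ Blk n j
    · have h2 : uV (i + 2 * e) ∈ Blk n j := by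
        rw [uV_mem_Blk he] at h3 ⊢
        grind
      obtain ⟨y, ⟨hyB, hyS⟩, hy⟩ := hj.exists_ne (uV (i + 3 * e))
      exact ⟨uV (i + 2 * e), ⟨h2, Set.mem_insert _ _⟩, y, ⟨hyB, .inr ⟨hyS, hy⟩⟩,
        fun h => hu2 (h ▸ hyS)⟩
    · exact hj.mono fun x hx => ⟨hx.1, .inr ⟨hx.2, fun h => h3 (h ▸ hx.1)⟩⟩

/-- One step of the improvement: a light block can be repaired without creating a new one. -/
lemma exists_repair {n : ℕ} (hn : 11 ≤ n) {f i e : ZMod n} (he : IsDir e) {S : Set (PVert n)}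
    (hS : MinDomF n f S) (hN : Nbr n f ∩ S = ∅) (hi : ¬2 ≤ gam n i S)
    (h2 : i + 2 * e ≠ f) (hl : i + 2 * e ≠ f - e) (hr : i + 2 * e ≠ f + e) :
    ∃ S' : Set (PVert n), MinDomF n f S' ∧ Nbr n f ∩ S' = ∅ ∧ 2 ≤ gam n i S' ∧
      ∀ j, 2 ≤ gam n j S → 2 ≤ gam n j S' := by
  obtain ⟨-, e2, e3, -⟩ := dir_ne_zero hn he
  have hne : ∀ d : ZMod n, IsDir d → i ≠ f + d := by
    rintro d hd rfl
    exact hi (two_le_gam_side hn hd hS.1 hN)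
  have hu : uV i ∈ S := by
    refine uV_mem_of_gam_lt_two hn he hS.1 hi ?_ ?_ ?_
    · rintro rfl
      exact hi (two_le_gam_center hn hS.1 hN)
    · exact fun h => hne (-e) he.neg (by linear_combination h)
    · exact fun h => hne e he (by linear_combination h)
  obtain ⟨hu2, hu3, hv3, hv4⟩ := pattern_of_gam_lt_two hn he hS.1 hi hu h2
  refine ⟨shift S i e, ⟨isDomSetF_shift hn he hS.1 h2 hv3 hv4, ?_⟩, ?_, ?_, fun j =>
    two_le_gam_shift hn he hu2 hv3 hv4⟩
  · rw [shift, Set.ncard_exchange hu2 hu3, hS.2]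
  · rw [nbr_inter_eq_empty_iff he] at hN ⊢
    simp only [uV_mem_shift, vV_mem_shift]
    tauto
  · rw [two_le_gam_iff]
    refine ⟨uV i, ⟨?_, uV_mem_shift.2 (.inr ⟨hu, ?_⟩)⟩, uV (i + 2 * e),
      ⟨?_, uV_mem_shift.2 (.inl rfl)⟩, ?_⟩
    · simp [uV_mem_Blk he]
    · exact fun h => e3 (by linear_combination -h)
    · simp [uV_mem_Blk he]
    · simpa using e2

lemma exists_repair_of_gam_lt_two {n : ℕ} (hn : 11 ≤ n) {f i : ZMod n} {S : Set (PVert n)}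
    (hS : MinDomF n f S) (hN : Nbr n f ∩ S = ∅) (hi : ¬2 ≤ gam n i S) :
    ∃ S' : Set (PVert n), MinDomF n f S' ∧ Nbr n f ∩ S' = ∅ ∧ 2 ≤ gam n i S' ∧
      ∀ j, 2 ≤ gam n j S → 2 ≤ gam n j S' := by
  by_cases h : i + 2 ≠ f ∧ i + 2 ≠ f - 1 ∧ i + 2 ≠ f + 1
  · exact exists_repair hn (.inl rfl) hS hN hi (by simpa using h.1) (by simpa using h.2.1)
      (by simpa using h.2.2)
  · obtain ⟨-, e2, e3, e4, e5, e6⟩ := small_ne_zero hn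
    refine exists_repair hn (.inr rfl) hS hN hi ?_ ?_ ?_ <;> grind

/-- if some minimum dominating set of `P_f(n,2)` avoids
`N(u_f)`, then there is one that moreover has `γ_i ≥ 2` for all `i`. -/
theorem exists_typeI (n : ℕ) (hn : 11 ≤ n) (f : ZMod n)
    (h : ∃ S : Set (PVert n), MinDomF n f S ∧ Nbr n f ∩ S = ∅) :
    ∃ S' : Set (PVert n), MinDomF n f S' ∧ Nbr n f ∩ S' = ∅ ∧
      ∀ i : ZMod n, 2 ≤ gam n i S' := by
  obtain ⟨S₀, hS₀⟩ := h
  have : NeZero n := ⟨by omega⟩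
  obtain ⟨S, ⟨hS, hN⟩, hmin⟩ := exists_minimalFor_of_wellFoundedLT
    (fun S : Set (PVert n) => MinDomF n f S ∧ Nbr n f ∩ S = ∅)
    (fun S => {i : ZMod n | ¬2 ≤ gam n i S}.ncard) ⟨S₀, hS₀⟩
  refine ⟨S, hS, hN, fun i => ?_⟩
  by_contra hi
  obtain ⟨S', hS', hN', hi', hmono⟩ := exists_repair_of_gam_lt_two hn hS hN hi
  have hlt : {j : ZMod n | ¬2 ≤ gam n j S'}.ncard < {j : ZMod n | ¬2 ≤ gam n j S}.ncard :=
    Set.ncard_lt_ncard ⟨fun j hj hjS => hj (hmono j hjS), fun hsub => hsub hi hi'⟩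
  exact hlt.not_ge (hmin ⟨hS', hN'⟩ hlt.le)

end PetersenDom
end

section
/- Let n ≥ 11, let f ∈ ℤ/nℤ, and let S be a Type II or Type III set for P_f(n,2) whose couple number is minimal among all sets of the same type. If i and j are distinct indices with i, j ∉ F and γ_i(S) = γ_j(S) = 2, then j ≠ i + 4 and j ≠ i − 4 (modulo n). -/
namespace PetersenDom

/-- The indicator of `S` on the outer vertex `u_{i+k}`. -/
noncomputable def outerInd {n : ℕ} (S : Set (PVert n)) (i : ZMod n) (k : ℤ) : ℕ :=
  S.indicator 1 (uV (i + k))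

/-- The indicator of `S` on the inner vertex `v_{i+k}`. -/
noncomputable def innerInd {n : ℕ} (S : Set (PVert n)) (i : ZMod n) (k : ℤ) : ℕ :=
  S.indicator 1 (vV (i + k))

section Indicator

variable {n : ℕ} {S : Set (PVert n)} {i : ZMod n} {k : ℤ}

lemma outerInd_pos (h : uV (i + (k : ZMod n)) ∈ S) : 1 ≤ outerInd S i k := by
  simp [outerInd, h]

lemma innerInd_pos (h : vV (i + (k : ZMod n)) ∈ S) : 1 ≤ innerInd S i k := by
  simp [innerInd, h]

lemma IsDomSetF.outer_dominated {f : ZMod n} (h : IsDomSetF n f S) (hk : i + k ≠ f) :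
    1 ≤ outerInd S i (k - 1) + outerInd S i k + outerInd S i (k + 1) + innerInd S i k := by
  rcases h.2 (uV (i + k)) (by simpa [uV] using hk) with hS | ⟨w, hwS, hadj⟩
  · have := outerInd_pos hS
    omega
  simp only [P2, SimpleGraph.fromRel_adj] at hadj
  rcases hadj.2 with (⟨a, rfl, hb⟩ | ⟨a, rfl, hb⟩ | ⟨a, rfl, hb⟩) |
    (⟨a, ha, rfl⟩ | ⟨a, ha, rfl⟩ | ⟨a, ha, rfl⟩) <;>
    simp only [uV, vV, Sum.inl.injEq, reduceCtorEq] at *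
  · have := outerInd_pos (S := S) (i := i) (k := k - 1)
      (by rw [uV]; convert hwS using 2; push_cast; rw [add_sub, hb]; ring)
    omega
  · have := outerInd_pos (S := S) (i := i) (k := k + 1)
      (by rw [uV]; convert hwS using 2; push_cast; rw [← ha]; ring)
    omega
  · have := innerInd_pos (S := S) (i := i) (k := k) (by rwa [ha])
    omega

lemma IsDomSetF.inner_dominated {f : ZMod n} (h : IsDomSetF n f S) (i : ZMod n) (k : ℤ) :
    1 ≤ innerInd S i (k - 2) + innerInd S i k + innerInd S i (k + 2) + outerInd S i k := by
  rcases h.2 (vV (i + k)) (by simp [uV, vV]) with hS | ⟨w, hwS, hadj⟩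
  · have := innerInd_pos hS
    omega
  simp only [P2, SimpleGraph.fromRel_adj] at hadj
  rcases hadj.2 with (⟨a, rfl, hb⟩ | ⟨a, rfl, hb⟩ | ⟨a, rfl, hb⟩) |
    (⟨a, ha, rfl⟩ | ⟨a, ha, rfl⟩ | ⟨a, ha, rfl⟩) <;>
    simp only [uV, vV, Sum.inr.injEq, reduceCtorEq] at *
  · have := outerInd_pos (S := S) (i := i) (k := k) (by rwa [hb])
    omega
  · have := innerInd_pos (S := S) (i := i) (k := k - 2)
      (by rw [vV]; convert hwS using 2; push_cast; rw [add_sub, hb]; ring)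
    omega
  · have := innerInd_pos (S := S) (i := i) (k := k + 2)
      (by rw [vV]; convert hwS using 2; push_cast; rw [← ha]; ring)
    omega

end Indicator

lemma gam_eq_sum {n : ℕ} (hn : 5 ≤ n) (S : Set (PVert n)) (i : ZMod n) (k : ℤ) :
    gam n (i + k) S =
      ∑ m ∈ Finset.Icc (k - 2) (k + 2), (outerInd S i m + innerInd S i m) := by
  classical
  have hinj : Set.InjOn (fun m : ℤ => i + (m : ZMod n)) (Finset.Icc (k - 2) (k + 2)) := by
    intro a ha b hb hab
    simp only [Finset.coe_Icc, Set.mem_Icc] at ha hb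
    obtain ⟨c, hc⟩ := (ZMod.intCast_eq_intCast_iff_dvd_sub a b n).1 (add_left_cancel hab)
    have : c = 0 := by
      by_contra h
      rcases lt_or_gt_of_ne h with h | h <;> nlinarith
    subst this
    linarith
  have hB : Blk n (i + k) = ((Finset.Icc (k - 2) (k + 2)).image (fun m : ℤ => i + (m : ZMod n))
      |>.disjSum ((Finset.Icc (k - 2) (k + 2)).image (fun m : ℤ => i + (m : ZMod n))) :
        Finset (PVert n)) := by
    have hI : Finset.Icc (k - 2) (k + 2) = {k - 2, k - 1, k, k + 1, k + 2} := by
      ext; simp; omega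
    ext w
    rcases w with w | w <;> simp [Blk, uV, vV, hI, add_assoc, add_sub, eq_comm]
  have hcard : ∀ B : Finset (PVert n),
      ((B : Set (PVert n)) ∩ S).ncard = ∑ w ∈ B, S.indicator 1 w := by
    intro B
    have : (B : Set (PVert n)) ∩ S = (B.filter (· ∈ S) : Finset (PVert n)) := by ext; simp
    rw [this, Set.ncard_coe_finset, Finset.card_filter]
    simp [Set.indicator_apply]
  rw [gam, hB, hcard, Finset.sum_disjSum, Finset.sum_image hinj, Finset.sum_image hinj,
    Finset.sum_add_distrib]
  rfl

lemma gam_eq {n : ℕ} (hn : 5 ≤ n) (S : Set (PVert n)) (i : ZMod n) (k : ℤ) :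
    gam n (i + k) S =
      outerInd S i (k - 2) + innerInd S i (k - 2) + outerInd S i (k - 1) + innerInd S i (k - 1) +
      outerInd S i k + innerInd S i k + outerInd S i (k + 1) + innerInd S i (k + 1) +
      outerInd S i (k + 2) + innerInd S i (k + 2) := by
  have hI : Finset.Icc (k - 2) (k + 2) = {k - 2, k - 1, k, k + 1, k + 2} := by
    ext; simp; omega
  rw [gam_eq_sum hn, hI]
  repeat rw [Finset.sum_insert (by simp <;> omega)]
  rw [Finset.sum_singleton]
  omega

lemma add_ne_of_notMem_Fset {n : ℕ} {f i : ZMod n} (hi : i ∉ Fset n f) :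
    i - 1 ≠ f ∧ i + 1 ≠ f ∧ i + 2 ≠ f := by
  simp only [Fset, Set.mem_insert_iff, Set.mem_singleton_iff, not_or] at hi
  refine ⟨?_, ?_, ?_⟩ <;> rintro rfl <;> simp at hi

/-- The blocks `B_i` and `B_{i+4}` cannot both meet a dominating set of `P_f(n,2)` in two
vertices: each would contain its central outer vertex, and the two remaining vertices do not
suffice to dominate `v_{i+1}`, `u_{i+2}`, `v_{i+2}` and `v_{i+3}`. -/
lemma IsDomSetF.gam_add_four_ne_two {n : ℕ} (hn : 5 ≤ n) {f : ZMod n} {S : Set (PVert n)}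
    (h : IsDomSetF n f S) {i : ZMod n} (hi : i ∉ Fset n f) (hj : i + 4 ∉ Fset n f)
    (h2i : gam n i S = 2) : gam n (i + 4) S ≠ 2 := by
  intro h2j
  obtain ⟨a₁, a₂, a₃⟩ := add_ne_of_notMem_Fset hi
  obtain ⟨b₁, b₂, -⟩ := add_ne_of_notMem_Fset hj
  have g₀ := gam_eq hn S i 0
  have g₄ := gam_eq hn S i 4
  have u₁ := h.outer_dominated (i := i) (k := -1) (by simpa [← sub_eq_add_neg] using a₁)
  have u₂ := h.outer_dominated (i := i) (k := 1) (by simpa using a₂)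
  have u₃ := h.outer_dominated (i := i) (k := 2) (by simpa using a₃)
  have u₄ := h.outer_dominated (i := i) (k := 3) (by convert b₁ using 1; push_cast; ring)
  have u₅ := h.outer_dominated (i := i) (k := 5) (by convert b₂ using 1; push_cast; ring)
  have v₀ := h.inner_dominated i 0
  have v₁ := h.inner_dominated i 1
  have v₂ := h.inner_dominated i 2
  have v₃ := h.inner_dominated i 3
  have v₄ := h.inner_dominated i 4
  norm_num at g₀ g₄ u₁ u₂ u₃ u₄ u₅ v₀ v₁ v₂ v₃ v₄
  have c₀ : 1 ≤ outerInd S i 0 := by omega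
  have c₄ : 1 ≤ outerInd S i 4 := by omega
  rcases Nat.eq_zero_or_pos (outerInd S i 1) with h₁ | h₁ <;> omega

/-- for a Type II or Type III set `S` of minimal couple number
among sets of the same type, two distinct indices `i, j ∉ F` with
`γ_i(S) = γ_j(S) = 2` satisfy `j ≠ i + 4` and `j ≠ i - 4` (mod `n`). -/
theorem couple_indices_not_four_apart (n : ℕ) (hn : 11 ≤ n) (f : ZMod n)
    (S : Set (PVert n))
    (hS : (TypeII n f S ∧
            ∀ T : Set (PVert n), TypeII n f T → coupleNum n f S ≤ coupleNum n f T) ∨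
          (TypeIII n f S ∧
            ∀ T : Set (PVert n), TypeIII n f T → coupleNum n f S ≤ coupleNum n f T))
    (i j : ZMod n) (hij : i ≠ j) (hi : i ∉ Fset n f) (hj : j ∉ Fset n f)
    (h2i : gam n i S = 2) (h2j : gam n j S = 2) :
    j ≠ i + 4 ∧ j ≠ i - 4 := by
  have hdom : IsDomSetF n f S := by
    rcases hS with h | h <;> exact h.1.1.1.1
  refine ⟨?_, fun h => ?_⟩
  · rintro rfl
    exact hdom.gam_add_four_ne_two (by omega) hi hj h2i h2j
  · obtain rfl : i = j + 4 := by rw [h]; ring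
    exact hdom.gam_add_four_ne_two (by omega) hj hi h2j h2i

end PetersenDom
end
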